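/- arXiv:2106.12670 — 3 statements merged into one kernel-verified Lean document; each statement's English description precedes it below -/
import Mathlib

section
/- If μ is the d-dimensional Minkowski content measure on S ∈ 𝓜, then for every compact set K ⊆ S one has \overline{Cont}_d(K) ≤ μ(K). -/
open MeasureTheory Filter Metric Set
open scoped ENNReal Topology NNReal

/-- `Cont_d(S;r) = r^(d-n) λⁿ(B(S,r))`, where `B(S,r)` is the closed `r`-neighborhood. -/
noncomputable def contApprox (n : ℕ) (d : ℝ) (S : Set (EuclideanSpace ℝ (Fin n))) (r : ℝ) :
    ℝ≥0∞ :=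
  ENNReal.ofReal (r ^ (d - (n : ℝ))) * volume (cthickening r S)

/-- Upper `d`-dimensional Minkowski content. -/
noncomputable def upperCont (n : ℕ) (d : ℝ) (S : Set (EuclideanSpace ℝ (Fin n))) : ℝ≥0∞ :=
  Filter.limsup (contApprox n d S) (𝓝[>] (0 : ℝ))

/-- Lower `d`-dimensional Minkowski content. -/
noncomputable def lowerCont (n : ℕ) (d : ℝ) (S : Set (EuclideanSpace ℝ (Fin n))) : ℝ≥0∞ :=
  Filter.liminf (contApprox n d S) (𝓝[>] (0 : ℝ))

/-- The `d`-dimensional Minkowski content of `S` exists and equals `c`. -/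
def ContEq (n : ℕ) (d : ℝ) (S : Set (EuclideanSpace ℝ (Fin n))) (c : ℝ≥0∞) : Prop :=
  upperCont n d S = c ∧ lowerCont n d S = c

/-- The relative boundary `∂_S T = S ∩ cl(T) ∩ cl(S \ T)` of `T` in `S`. -/
def relBdry {X : Type*} [TopologicalSpace X] (S T : Set X) : Set X :=
  S ∩ closure T ∩ closure (S \ T)

/-- `𝓜`: sets expressible as the intersection of an open set with a closed set. -/
def MemM (n : ℕ) (S : Set (EuclideanSpace ℝ (Fin n))) : Prop :=
  ∃ U F : Set (EuclideanSpace ℝ (Fin n)), IsOpen U ∧ IsClosed F ∧ S = U ∩ F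

/-- `μ` is the `d`-dimensional Minkowski content measure on `S`. -/
def IsMinkowskiMeasure (n : ℕ) (d : ℝ) (S : Set (EuclideanSpace ℝ (Fin n)))
    (μ : Measure (EuclideanSpace ℝ (Fin n))) : Prop :=
  μ Sᶜ = 0 ∧ ∀ K : Set (EuclideanSpace ℝ (Fin n)), K ⊆ S → IsCompact K →
    μ K < ⊤ ∧ (μ (relBdry S K) = 0 → ContEq n d K (μ K))

/-- The relative boundary in `S` of a closed neighborhood of `K` lies in a level set of the distance
to `K`. -/
theorem relBdry_cthickening_inter_subset {X : Type*} [PseudoMetricSpace X] (S K : Set X) {t : ℝ}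
    (ht : 0 ≤ t) : relBdry S (cthickening t K ∩ S) ⊆ {x | infDist x K = t} := by
  rintro x ⟨⟨hxS, hxT⟩, hxC⟩
  have hle : infEDist x K ≤ ENNReal.ofReal t :=
    closure_minimal inter_subset_left isClosed_cthickening hxT
  have hge : ENNReal.ofReal t ≤ infEDist x K := by
    have hclosed : IsClosed {y | ENNReal.ofReal t ≤ infEDist y K} :=
      isClosed_le continuous_const continuous_infEDist
    refine closure_minimal (fun y hy => ?_) hclosed hxC
    by_contra hlt
    exact hy.2 ⟨mem_cthickening_iff.mpr (not_le.mp hlt).le, hy.1⟩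
  change (infEDist x K).toReal = t
  rw [le_antisymm hle hge, ENNReal.toReal_ofReal ht]

theorem upperCont_mono {n : ℕ} {d : ℝ} {S T : Set (EuclideanSpace ℝ (Fin n))} (h : S ⊆ T) :
    upperCont n d S ≤ upperCont n d T :=
  limsup_le_limsup (Eventually.of_forall fun r => by
    unfold contApprox
    gcongr
    exact cthickening_subset_of_subset r h)

/-- the upper Minkowski content of a compact subset is bounded by its measure. -/
theorem upperCont_le_minkowskiMeasure (n : ℕ) (hn : 1 ≤ n) (d : ℝ) (hd0 : 0 < d) (hdn : d < n)
    (S : Set (EuclideanSpace ℝ (Fin n))) (hS : MemM n S)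
    (μ : Measure (EuclideanSpace ℝ (Fin n))) (hμ : IsMinkowskiMeasure n d S μ)
    (K : Set (EuclideanSpace ℝ (Fin n))) (hKS : K ⊆ S) (hK : IsCompact K) :
    upperCont n d K ≤ μ K := by
  obtain ⟨U, F, hU, hF, rfl⟩ := hS
  obtain ⟨δ, hδ, hδU⟩ := hK.exists_cthickening_subset_open hU (hKS.trans inter_subset_left)
  have hnbhd {t : ℝ} (ht : t ≤ δ) : IsCompact (cthickening t K ∩ (U ∩ F)) := by
    rw [← inter_assoc, inter_eq_left.mpr ((cthickening_mono ht K).trans hδU)]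
    exact hK.cthickening.inter_right hF
  have hmeas (T : Set (EuclideanSpace ℝ (Fin n))) : μ (T ∩ (U ∩ F)) = μ T :=
    measure_inter_conull hμ.1
  have hfin : μ (cthickening δ K) ≠ ⊤ := by
    rw [← hmeas]
    exact (hμ.2 _ inter_subset_right (hnbhd le_rfl)).1.ne
  have hlim : Tendsto (fun t => μ (cthickening t K)) (𝓝[>] 0) (𝓝 (μ K)) :=
    (tendsto_measure_cthickening_of_isClosed ⟨δ, hδ, hfin⟩ hK.isClosed).mono_left
      nhdsWithin_le_nhds
  refine le_of_forall_gt_imp_ge_of_dense fun c hc => ?_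
  obtain ⟨ε, hε, hεc⟩ := mem_nhdsGT_iff_exists_Ioo_subset.mp (hlim.eventually_lt_const hc)
  have : IsFiniteMeasure (μ.restrict (cthickening δ K)) := isFiniteMeasure_restrict.mpr hfin
  have hcount : {t : ℝ | 0 < μ.restrict (cthickening δ K) {x | infDist x K = t}}.Countable :=
    Measure.countable_meas_level_set_pos (measurable_infDist (s := K))
  obtain ⟨t, htnull, ht0, htlt⟩ := (hcount.dense_compl ℝ).exists_between
    (lt_min hδ (mem_Ioi.mp hε))
  have htδ : t ≤ δ := (htlt.trans_le (min_le_left _ _)).le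
  have hbdry : μ (relBdry (U ∩ F) (cthickening t K ∩ (U ∩ F))) = 0 := by
    refine measure_mono_null (t := {x | infDist x K = t} ∩ cthickening δ K)
      (subset_inter (relBdry_cthickening_inter_subset _ _ ht0.le) ?_) ?_
    · rintro x ⟨⟨-, hx⟩, -⟩
      exact cthickening_mono htδ K (closure_minimal inter_subset_left isClosed_cthickening hx)
    · rw [← Measure.restrict_apply' isClosed_cthickening.measurableSet]
      simpa using htnull
  calc upperCont n d K ≤ upperCont n d (cthickening t K ∩ (U ∩ F)) :=
        upperCont_mono (subset_inter (self_subset_cthickening K) hKS)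
    _ = μ (cthickening t K ∩ (U ∩ F)) :=
        ((hμ.2 _ inter_subset_right (hnbhd htδ)).2 hbdry).1
    _ = μ (cthickening t K) := hmeas _
    _ ≤ c := le_of_lt (hεc ⟨ht0, htlt.trans_le (min_le_right _ _)⟩)
end

section
/- Let S ⊆ ℝⁿ be compact, and for r > 0 let μ_r be the measure on ℝⁿ with density r^{d-n} 1_{B(S,r)} with respect to Lebesgue measure λⁿ. If μ is a finite Borel measure on ℝⁿ such that μ_r converges weakly to μ as r → 0⁺ (i.e., ∫ f dμ_r → ∫ f dμ for every bounded continuous f : ℝⁿ → ℝ), then μ is the d-dimensional Minkowski content measure on S. -/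
open MeasureTheory Filter Metric Set
open scoped ENNReal Topology NNReal

/-- The measure `μ_r` with density `r^(d-n) 1_(B(S,r))` with respect to Lebesgue measure. -/
noncomputable def muApprox (n : ℕ) (d : ℝ) (S : Set (EuclideanSpace ℝ (Fin n))) (r : ℝ) :
    Measure (EuclideanSpace ℝ (Fin n)) :=
  ENNReal.ofReal (r ^ (d - (n : ℝ))) • (volume.restrict (cthickening r S))

theorem isFiniteMeasure_muApprox {n : ℕ} (d : ℝ) {S : Set (EuclideanSpace ℝ (Fin n))}
    (hS : IsCompact S) (r : ℝ) : IsFiniteMeasure (muApprox n d S r) := by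
  have : IsFiniteMeasure (volume.restrict (cthickening r S)) :=
    ⟨by simpa using hS.cthickening.measure_lt_top⟩
  exact Measure.smul_finite _ ENNReal.ofReal_ne_top

theorem muApprox_univ {n : ℕ} (d : ℝ) (S : Set (EuclideanSpace ℝ (Fin n))) (r : ℝ) :
    muApprox n d S r univ = contApprox n d S r := by
  simp [muApprox, contApprox]

theorem contApprox_le_muApprox_cthickening {n : ℕ} (d : ℝ)
    {S K : Set (EuclideanSpace ℝ (Fin n))} (hKS : K ⊆ S) {r δ : ℝ} (hr : r ≤ δ) :
    contApprox n d K r ≤ muApprox n d S r (cthickening δ K) := by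
  rw [muApprox, Measure.smul_apply, smul_eq_mul,
    Measure.restrict_apply isClosed_cthickening.measurableSet]
  exact mul_le_mul_right (measure_mono (subset_inter (cthickening_mono hr K)
    (cthickening_subset_of_subset r hKS))) _

/-- The weak limit of the measures `μ_r` bounds the upper content of closed subsets of `S`. -/
theorem upperCont_le_of_weak_limit {n : ℕ} {d : ℝ} {S K : Set (EuclideanSpace ℝ (Fin n))}
    (hKS : K ⊆ S) (hK : IsClosed K) {μ : Measure (EuclideanSpace ℝ (Fin n))} [IsFiniteMeasure μ]
    (hlim : ∀ F : Set (EuclideanSpace ℝ (Fin n)), IsClosed F →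
      limsup (fun r => muApprox n d S r F) (𝓝[>] (0 : ℝ)) ≤ μ F) :
    upperCont n d K ≤ μ K := by
  have hthick : Tendsto (fun δ => μ (cthickening δ K)) (𝓝[>] (0 : ℝ)) (𝓝 (μ K)) :=
    (tendsto_measure_cthickening_of_isClosed ⟨1, one_pos, measure_ne_top _ _⟩ hK).mono_left
      nhdsWithin_le_nhds
  refine ge_of_tendsto hthick ?_
  filter_upwards [self_mem_nhdsWithin] with δ hδ
  refine le_trans (limsup_le_limsup ?_) (hlim _ isClosed_cthickening)
  filter_upwards [Ioc_mem_nhdsGT hδ] with r hr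
  exact contApprox_le_muApprox_cthickening d hKS hr.2

theorem contApprox_union_le {n : ℕ} (d : ℝ) (K C : Set (EuclideanSpace ℝ (Fin n))) (r : ℝ) :
    contApprox n d (K ∪ C) r ≤ contApprox n d K r + contApprox n d C r := by
  rw [contApprox, contApprox, contApprox, cthickening_union, ← mul_add]
  exact mul_le_mul_right (measure_union_le _ _) _

/-- Subadditivity of the content when the content of the union exists. -/
theorem le_lowerCont_add_upperCont {n : ℕ} {d : ℝ} {K C : Set (EuclideanSpace ℝ (Fin n))}
    {m : ℝ≥0∞} (hm : Tendsto (contApprox n d (K ∪ C)) (𝓝[>] (0 : ℝ)) (𝓝 m)) :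
    m ≤ lowerCont n d K + upperCont n d C := by
  rcases eq_or_ne (upperCont n d C) ⊤ with htop | htop
  · simp [htop]
  refine ENNReal.le_of_forall_pos_le_add fun ε hε _ => ?_
  have hC : ∀ᶠ r in 𝓝[>] (0 : ℝ), contApprox n d C r < upperCont n d C + ε :=
    eventually_lt_of_limsup_lt (ENNReal.lt_add_right htop (by simpa using hε.ne'))
  have hle : liminf (fun r => contApprox n d (K ∪ C) r - (upperCont n d C + ε)) (𝓝[>] (0 : ℝ))
      ≤ lowerCont n d K := by
    refine liminf_le_liminf ?_
    filter_upwards [hC] with r hr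
    exact tsub_le_iff_right.2 ((contApprox_union_le d K C r).trans (by gcongr))
  rw [ENNReal.liminf_sub_const, hm.liminf_eq, tsub_le_iff_right] at hle
  rwa [add_assoc]

/-- if `μ_r` converges weakly to a finite Borel measure `μ` as `r → 0⁺`, then `μ`
is the `d`-dimensional Minkowski content measure on the compact set `S`. -/
theorem isMinkowskiMeasure_of_weak_limit (n : ℕ) (hn : 1 ≤ n) (d : ℝ) (hd0 : 0 < d) (hdn : d < n)
    (S : Set (EuclideanSpace ℝ (Fin n))) (hS : IsCompact S)
    (μ : Measure (EuclideanSpace ℝ (Fin n))) [IsFiniteMeasure μ]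
    (hweak : ∀ f : BoundedContinuousFunction (EuclideanSpace ℝ (Fin n)) ℝ,
      Tendsto (fun r : ℝ => ∫ x, f x ∂(muApprox n d S r)) (𝓝[>] (0 : ℝ))
        (𝓝 (∫ x, f x ∂μ))) :
    IsMinkowskiMeasure n d S μ := by
  have := isFiniteMeasure_muApprox d hS
  let μs : ℝ → FiniteMeasure (EuclideanSpace ℝ (Fin n)) := fun r => ⟨muApprox n d S r, this r⟩
  let μ' : FiniteMeasure (EuclideanSpace ℝ (Fin n)) := ⟨μ, inferInstance⟩
  have hconv : Tendsto μs (𝓝[>] (0 : ℝ)) (𝓝 μ') :=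
    FiniteMeasure.tendsto_iff_forall_integral_tendsto.2 hweak
  have hlim : ∀ F : Set (EuclideanSpace ℝ (Fin n)), IsClosed F →
      limsup (fun r => muApprox n d S r F) (𝓝[>] (0 : ℝ)) ≤ μ F := fun F hF =>
    FiniteMeasure.limsup_measure_closed_le_of_tendsto hconv hF
  have hmass : Tendsto (contApprox n d S) (𝓝[>] (0 : ℝ)) (𝓝 (μ univ)) := by
    have h := ENNReal.tendsto_coe.2 ((FiniteMeasure.continuous_mass.tendsto μ').comp hconv)
    simp only [Function.comp_def, FiniteMeasure.ennreal_mass] at h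
    exact h.congr fun r => muApprox_univ d S r
  constructor
  · have h : μ univ ≤ μ S :=
      hmass.limsup_eq.symm.trans_le (upperCont_le_of_weak_limit subset_rfl hS.isClosed hlim)
    rw [measure_compl hS.measurableSet (measure_ne_top _ _)]
    exact tsub_eq_zero_of_le h
  intro K hKS hK
  refine ⟨measure_lt_top _ _, fun hbdry => ?_⟩
  set C := closure (S \ K)
  have hCS : C ⊆ S := closure_minimal sdiff_subset hS.isClosed
  have hunion : K ∪ C = S := (union_subset hKS hCS).antisymm fun x hx =>
    (em (x ∈ K)).imp id fun h => subset_closure ⟨hx, h⟩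
  have hinter : μ (K ∩ C) = 0 := by
    rwa [relBdry, hK.isClosed.closure_eq, inter_eq_right.2 hKS] at hbdry
  have hupper := upperCont_le_of_weak_limit hKS hK.isClosed hlim
  have hlower : μ K ≤ lowerCont n d K := by
    refine ENNReal.le_of_add_le_add_right (measure_ne_top μ C) ?_
    calc μ K + μ C = μ (K ∪ C) :=
          (measure_union₀ isClosed_closure.measurableSet.nullMeasurableSet hinter).symm
      _ ≤ μ univ := measure_mono (subset_univ _)
      _ ≤ lowerCont n d K + upperCont n d C := le_lowerCont_add_upperCont (by rwa [hunion])
      _ ≤ lowerCont n d K + μ C := by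
          gcongr
          exact upperCont_le_of_weak_limit hCS isClosed_closure hlim
  have hle : lowerCont n d K ≤ upperCont n d K := liminf_le_limsup
  exact ⟨hupper.antisymm (hlower.trans hle), (hle.trans hupper).antisymm hlower⟩
end

section
/- (Conformal covariance) Let G ⊆ ℝⁿ be open and let φ : G → ℝⁿ be injective, continuously differentiable on G, and conformal, meaning there is a function s : G → (0, ∞) such that for every x ∈ G and every vector v ∈ ℝⁿ, ‖Dφ(x)v‖ = s(x)‖v‖ (the derivative Dφ(x) is s(x) times a linear isometry); write |φ'(x)| = s(x). Let S ∈ 𝓜 be relatively closed in G (i.e., S = F ∩ G for some closed F), and let μ be the d-dimensional Minkowski content measure on S. Then φ(S) ∈ 𝓜 and the pushforward ν := φ_*(|φ'|^d · μ) of the measure μ weighted by the density x ↦ |φ'(x)|^d is the d-dimensional Minkowski content measure on φ(S). -/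
open MeasureTheory Filter Metric Set
open scoped ENNReal Topology NNReal

lemma abs_det_eq_pow_of_norm_map {E : Type*} [NormedAddCommGroup E] [InnerProductSpace ℝ E]
    [FiniteDimensional ℝ E] (A : E →L[ℝ] E) {c : ℝ} (hc : 0 < c)
    (hA : ∀ v, ‖A v‖ = c * ‖v‖) : |A.det| = c ^ Module.finrank ℝ E := by
  let B : E →ₗᵢ[ℝ] E :=
    { toLinearMap := c⁻¹ • (A : E →ₗ[ℝ] E)
      norm_map' := fun v => by
        simp [norm_smul, hA, abs_of_pos hc, hc.ne'] }
  have hAB : (A : E →ₗ[ℝ] E) = c • B.toLinearMap := by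
    ext1 v
    simp [B, smul_smul, hc.ne']
  have h := LinearMap.normDet_eq_abs_det (A : E →ₗ[ℝ] E)
  rw [hAB, LinearMap.normDet_smul, B.normDet_eq_one, ← hAB] at h
  rw [ContinuousLinearMap.det, ← h]
  simp [abs_of_pos hc]

lemma exists_continuousLinearEquiv_of_norm_map {E : Type*} [NormedAddCommGroup E]
    [NormedSpace ℝ E] [FiniteDimensional ℝ E] (A : E →L[ℝ] E) {c : ℝ} (hc : 0 < c)
    (hA : ∀ v, ‖A v‖ = c * ‖v‖) : ∃ A' : E ≃L[ℝ] E, (A' : E →L[ℝ] E) = A := by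
  have hinj : Function.Injective (A : E →ₗ[ℝ] E) := by
    rw [injective_iff_map_eq_zero]
    intro v hv
    have h := hA v
    rw [show A v = 0 from hv, norm_zero] at h
    simpa [hc.ne'] using h.symm
  exact ⟨(LinearEquiv.ofInjectiveEndo _ hinj).toContinuousLinearEquiv, by ext v; rfl⟩

/-- A map with derivative bounded by `C` near a compact set `K` sends small closed thickenings
of `K` into closed thickenings of the image, with radius multiplied by `C`. -/
lemma exists_forall_image_cthickening_subset {E : Type*} [NormedAddCommGroup E] [NormedSpace ℝ E]
    {U K : Set E} (hU : IsOpen U) (hK : IsCompact K) (hKU : K ⊆ U)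
    {f : E → E} {f' : E → E →L[ℝ] E} {C : ℝ}
    (hf : ∀ x ∈ U, HasFDerivAt f (f' x) x) (hC : ∀ x ∈ U, ‖f' x‖ ≤ C) :
    ∃ δ > 0, ∀ r, 0 ≤ r → r ≤ δ →
      cthickening r K ⊆ U ∧ f '' cthickening r K ⊆ cthickening (C * r) (f '' K) := by
  obtain ⟨δ, hδ, hδU⟩ := hK.exists_cthickening_subset_open hU hKU
  refine ⟨δ, hδ, fun r hr hrδ => ?_⟩
  have hrU : cthickening r K ⊆ U := (cthickening_mono hrδ K).trans hδU
  refine ⟨hrU, ?_⟩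
  rintro _ ⟨x, hx, rfl⟩
  rw [hK.cthickening_eq_biUnion_closedBall hr] at hx
  obtain ⟨z, hz, hxz⟩ := mem_iUnion₂.1 hx
  have hball : closedBall z r ⊆ U := (closedBall_subset_cthickening hz r).trans hrU
  refine mem_cthickening_of_dist_le _ (f z) _ _ (mem_image_of_mem f hz) ?_
  have h := (convex_closedBall z r).norm_image_sub_le_of_norm_hasFDerivWithin_le
    (fun y hy => (hf y (hball hy)).hasFDerivWithinAt) (fun y hy => hC y (hball hy))
    (mem_closedBall_self hr) hxz
  rw [dist_eq_norm]
  have hC0 : 0 ≤ C := (norm_nonneg _).trans (hC z (hKU hz))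
  refine h.trans (mul_le_mul_of_nonneg_left ?_ hC0)
  rwa [← dist_eq_norm]

section Conformal

variable {n : ℕ} {U : Set (EuclideanSpace ℝ (Fin n))}
  {φ : EuclideanSpace ℝ (Fin n) → EuclideanSpace ℝ (Fin n)}
  {φ' : EuclideanSpace ℝ (Fin n) → (EuclideanSpace ℝ (Fin n) →L[ℝ] EuclideanSpace ℝ (Fin n))}
  {s : EuclideanSpace ℝ (Fin n) → ℝ}

lemma map_nhds_eq_of_conformal (hU : IsOpen U) (hderiv : ∀ x ∈ U, HasFDerivAt φ (φ' x) x)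
    (hcont : ContinuousOn φ' U) (hs : ∀ x ∈ U, 0 < s x)
    (hconf : ∀ x ∈ U, ∀ v, ‖φ' x v‖ = s x * ‖v‖)
    {x : EuclideanSpace ℝ (Fin n)} (hx : x ∈ U) : map φ (𝓝 x) = 𝓝 (φ x) := by
  obtain ⟨A, hA⟩ := exists_continuousLinearEquiv_of_norm_map (φ' x) (hs x hx) (hconf x hx)
  have h := hasStrictFDerivAt_of_hasFDerivAt_of_continuousAt
    (eventually_of_mem (hU.mem_nhds hx) hderiv) (hcont.continuousAt (hU.mem_nhds hx))
  rw [← hA] at h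
  exact h.map_nhds_eq_of_equiv

lemma isOpen_image_of_conformal (hU : IsOpen U) (hderiv : ∀ x ∈ U, HasFDerivAt φ (φ' x) x)
    (hcont : ContinuousOn φ' U) (hs : ∀ x ∈ U, 0 < s x)
    (hconf : ∀ x ∈ U, ∀ v, ‖φ' x v‖ = s x * ‖v‖)
    {V : Set (EuclideanSpace ℝ (Fin n))} (hV : IsOpen V) (hVU : V ⊆ U) : IsOpen (φ '' V) := by
  rw [isOpen_iff_mem_nhds]
  rintro _ ⟨x, hx, rfl⟩
  rw [← map_nhds_eq_of_conformal hU hderiv hcont hs hconf (hVU hx)]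
  exact image_mem_map (hV.mem_nhds hx)

lemma continuousAt_invFunOn_of_conformal (hU : IsOpen U) (hinj : InjOn φ U)
    (hderiv : ∀ x ∈ U, HasFDerivAt φ (φ' x) x)
    (hcont : ContinuousOn φ' U) (hs : ∀ x ∈ U, 0 < s x)
    (hconf : ∀ x ∈ U, ∀ v, ‖φ' x v‖ = s x * ‖v‖)
    {x : EuclideanSpace ℝ (Fin n)} (hx : x ∈ U) :
    ContinuousAt (Function.invFunOn φ U) (φ x) := by
  rw [ContinuousAt, hinj.leftInvOn_invFunOn hx,
    ← map_nhds_eq_of_conformal hU hderiv hcont hs hconf hx, tendsto_map'_iff]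
  refine tendsto_id.congr' ?_
  filter_upwards [hU.mem_nhds hx] with y hy
  exact (hinj.leftInvOn_invFunOn hy).symm

lemma hasFDerivAt_invFunOn_of_conformal (hU : IsOpen U) (hinj : InjOn φ U)
    (hderiv : ∀ x ∈ U, HasFDerivAt φ (φ' x) x)
    (hcont : ContinuousOn φ' U) (hs : ∀ x ∈ U, 0 < s x)
    (hconf : ∀ x ∈ U, ∀ v, ‖φ' x v‖ = s x * ‖v‖)
    {x : EuclideanSpace ℝ (Fin n)} (hx : x ∈ U) :
    ∃ A : EuclideanSpace ℝ (Fin n) →L[ℝ] EuclideanSpace ℝ (Fin n),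
      HasFDerivAt (Function.invFunOn φ U) A (φ x) ∧ ‖A‖ ≤ (s x)⁻¹ := by
  obtain ⟨A, hA⟩ := exists_continuousLinearEquiv_of_norm_map (φ' x) (hs x hx) (hconf x hx)
  refine ⟨A.symm, HasFDerivAt.of_local_left_inverse
    (continuousAt_invFunOn_of_conformal hU hinj hderiv hcont hs hconf hx) (f := φ) ?_ ?_, ?_⟩
  · rw [hinj.leftInvOn_invFunOn hx, hA]
    exact hderiv x hx
  · filter_upwards [(isOpen_image_of_conformal hU hderiv hcont hs hconf hU
      Subset.rfl).mem_nhds (mem_image_of_mem φ hx)] with y hy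
    exact Function.invFunOn_eq hy
  · refine ContinuousLinearMap.opNorm_le_bound _ (inv_nonneg.2 (hs x hx).le) fun v => ?_
    have h := hconf x hx (A.symm v)
    rw [← hA] at h
    simp only [ContinuousLinearEquiv.coe_coe, ContinuousLinearEquiv.apply_symm_apply] at h ⊢
    rw [h, inv_mul_cancel_left₀ (hs x hx).ne']

lemma volume_image_eq_of_conformal (hinj : InjOn φ U)
    (hderiv : ∀ x ∈ U, HasFDerivAt φ (φ' x) x) (hs : ∀ x ∈ U, 0 < s x)
    (hconf : ∀ x ∈ U, ∀ v, ‖φ' x v‖ = s x * ‖v‖)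
    {A : Set (EuclideanSpace ℝ (Fin n))} (hA : MeasurableSet A) (hAU : A ⊆ U) :
    volume (φ '' A) = ∫⁻ x in A, ENNReal.ofReal (s x ^ n) := by
  rw [← lintegral_abs_det_fderiv_eq_addHaar_image volume hA
    (fun x hx => (hderiv x (hAU hx)).hasFDerivWithinAt) (hinj.mono hAU)]
  refine setLIntegral_congr_fun hA fun x hx => ?_
  rw [abs_det_eq_pow_of_norm_map _ (hs x (hAU hx)) (hconf x (hAU hx)), finrank_euclideanSpace_fin]

lemma volume_image_le_of_conformal (hinj : InjOn φ U)
    (hderiv : ∀ x ∈ U, HasFDerivAt φ (φ' x) x) (hs : ∀ x ∈ U, 0 < s x)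
    (hconf : ∀ x ∈ U, ∀ v, ‖φ' x v‖ = s x * ‖v‖) {M : ℝ} (hM : ∀ x ∈ U, s x ≤ M)
    {A : Set (EuclideanSpace ℝ (Fin n))} (hA : MeasurableSet A) (hAU : A ⊆ U) :
    volume (φ '' A) ≤ ENNReal.ofReal (M ^ n) * volume A := by
  rw [volume_image_eq_of_conformal hinj hderiv hs hconf hA hAU, ← setLIntegral_const]
  exact setLIntegral_mono' hA fun x hx => ENNReal.ofReal_le_ofReal
    (pow_le_pow_left₀ (hs x (hAU hx)).le (hM x (hAU hx)) n)

lemma le_volume_image_of_conformal (hinj : InjOn φ U)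
    (hderiv : ∀ x ∈ U, HasFDerivAt φ (φ' x) x) (hs : ∀ x ∈ U, 0 < s x)
    (hconf : ∀ x ∈ U, ∀ v, ‖φ' x v‖ = s x * ‖v‖) {m : ℝ} (hm0 : 0 ≤ m) (hm : ∀ x ∈ U, m ≤ s x)
    {A : Set (EuclideanSpace ℝ (Fin n))} (hA : MeasurableSet A) (hAU : A ⊆ U) :
    ENNReal.ofReal (m ^ n) * volume A ≤ volume (φ '' A) := by
  rw [volume_image_eq_of_conformal hinj hderiv hs hconf hA hAU, ← setLIntegral_const]
  exact setLIntegral_mono' hA fun x hx => ENNReal.ofReal_le_ofReal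
    (pow_le_pow_left₀ hm0 (hm x (hAU hx)) n)

lemma contApprox_mul_left {d c r : ℝ} (hc : 0 < c) (hr : 0 < r)
    (K : Set (EuclideanSpace ℝ (Fin n))) :
    ENNReal.ofReal (r ^ (d - (n : ℝ))) * volume (cthickening (c * r) K) =
      ENNReal.ofReal (c ^ ((n : ℝ) - d)) * contApprox n d K (c * r) := by
  rw [contApprox, ← mul_assoc, ← ENNReal.ofReal_mul (by positivity),
    Real.mul_rpow hc.le hr.le, ← mul_assoc, ← Real.rpow_add hc]
  simp

lemma tendsto_const_mul_nhdsGT_zero {c : ℝ} (hc : 0 < c) :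
    Tendsto (fun r : ℝ => c * r) (𝓝[>] 0) (𝓝[>] 0) := by
  refine tendsto_nhdsWithin_of_tendsto_nhds_of_eventually_within _ ?_ ?_
  · have h : Tendsto (fun r : ℝ => c * r) (𝓝 0) (𝓝 (c * 0)) :=
      tendsto_id.const_mul c
    rw [mul_zero] at h
    exact h.mono_left nhdsWithin_le_nhds
  · filter_upwards [self_mem_nhdsWithin] with r hr
    exact mul_pos hc hr

lemma upperCont_image_le_of_conformal {d : ℝ} (hU : IsOpen U) (hinj : InjOn φ U)
    (hderiv : ∀ x ∈ U, HasFDerivAt φ (φ' x) x)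
    (hcont : ContinuousOn φ' U) {m M : ℝ} (hm0 : 0 < m) (hm : ∀ x ∈ U, m ≤ s x)
    (hM0 : 0 < M) (hM : ∀ x ∈ U, s x ≤ M)
    (hconf : ∀ x ∈ U, ∀ v, ‖φ' x v‖ = s x * ‖v‖)
    {K : Set (EuclideanSpace ℝ (Fin n))} (hK : IsCompact K) (hKU : K ⊆ U) :
    upperCont n d (φ '' K) ≤ ENNReal.ofReal (M ^ n * m ^ (d - n)) * upperCont n d K := by
  have hs : ∀ x ∈ U, 0 < s x := fun x hx => hm0.trans_le (hm x hx)
  have hφc : ContinuousOn φ U := fun x hx => (hderiv x hx).continuousAt.continuousWithinAt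
  have hφU := isOpen_image_of_conformal hU hderiv hcont hs hconf hU Subset.rfl
  choose! A hA using fun x (hx : x ∈ U) =>
    hasFDerivAt_invFunOn_of_conformal hU hinj hderiv hcont hs hconf hx
  obtain ⟨δ, hδ, hδK⟩ := exists_forall_image_cthickening_subset
    (f := Function.invFunOn φ U) (f' := fun y => A (Function.invFunOn φ U y)) (C := m⁻¹)
    hφU (hK.image_of_continuousOn (hφc.mono hKU)) (image_mono hKU)
    (by
      rintro _ ⟨x, hx, rfl⟩
      rw [hinj.leftInvOn_invFunOn hx]
      exact (hA x hx).1)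
    (by
      rintro _ ⟨x, hx, rfl⟩
      rw [hinj.leftInvOn_invFunOn hx]
      exact (hA x hx).2.trans (inv_anti₀ hm0 (hm x hx)))
  rw [hinj.invFunOn_image hKU] at hδK
  obtain ⟨η, hη, hηU⟩ := hK.exists_cthickening_subset_open hU hKU
  have hlim := tendsto_const_mul_nhdsGT_zero (inv_pos.2 hm0)
  have hev : ∀ᶠ r in 𝓝[>] (0 : ℝ), contApprox n d (φ '' K) r ≤
      ENNReal.ofReal (M ^ n * m ^ (d - n)) * contApprox n d K (m⁻¹ * r) := by
    filter_upwards [self_mem_nhdsWithin, nhdsWithin_le_nhds (Iic_mem_nhds hδ),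
      hlim.eventually (nhdsWithin_le_nhds (Iic_mem_nhds hη))] with r hr hrδ hrη
    have hr : 0 < r := hr
    obtain ⟨h1, h2⟩ := hδK r hr.le hrδ
    have hsub : cthickening r (φ '' K) ⊆ φ '' cthickening (m⁻¹ * r) K := fun y hy =>
      ⟨_, h2 (mem_image_of_mem _ hy), Function.invFunOn_eq (h1 hy)⟩
    calc contApprox n d (φ '' K) r ≤ ENNReal.ofReal (r ^ (d - (n : ℝ))) *
          (ENNReal.ofReal (M ^ n) * volume (cthickening (m⁻¹ * r) K)) := by
          rw [contApprox]
          gcongr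
          exact (measure_mono hsub).trans (volume_image_le_of_conformal hinj hderiv hs hconf hM
            isClosed_cthickening.measurableSet ((cthickening_mono hrη K).trans hηU))
      _ = _ := by
          rw [mul_left_comm, contApprox_mul_left (inv_pos.2 hm0) hr, ← mul_assoc,
            ← ENNReal.ofReal_mul (by positivity), Real.inv_rpow hm0.le, ← Real.rpow_neg hm0.le,
            neg_sub]
  calc upperCont n d (φ '' K)
      ≤ limsup (fun r => ENNReal.ofReal (M ^ n * m ^ (d - n)) * contApprox n d K (m⁻¹ * r))
        (𝓝[>] (0 : ℝ)) := limsup_le_limsup hev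
    _ = ENNReal.ofReal (M ^ n * m ^ (d - n)) *
        limsup (fun r => contApprox n d K (m⁻¹ * r)) (𝓝[>] (0 : ℝ)) :=
        ENNReal.limsup_const_mul_of_ne_top ENNReal.ofReal_ne_top
    _ ≤ _ := by
        gcongr
        exact limsup_le_limsup_of_le hlim

lemma le_lowerCont_image_of_conformal {d : ℝ} (hU : IsOpen U) (hinj : InjOn φ U)
    (hderiv : ∀ x ∈ U, HasFDerivAt φ (φ' x) x)
    {m M : ℝ} (hm0 : 0 < m) (hm : ∀ x ∈ U, m ≤ s x)
    (hM0 : 0 < M) (hM : ∀ x ∈ U, s x ≤ M)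
    (hconf : ∀ x ∈ U, ∀ v, ‖φ' x v‖ = s x * ‖v‖)
    {K : Set (EuclideanSpace ℝ (Fin n))} (hK : IsCompact K) (hKU : K ⊆ U) :
    ENNReal.ofReal (m ^ n * M ^ (d - n)) * lowerCont n d K ≤ lowerCont n d (φ '' K) := by
  have hs : ∀ x ∈ U, 0 < s x := fun x hx => hm0.trans_le (hm x hx)
  obtain ⟨δ, hδ, hδK⟩ := exists_forall_image_cthickening_subset (f := φ) (f' := φ') (C := M)
    hU hK hKU hderiv (fun x hx => ContinuousLinearMap.opNorm_le_bound _ hM0.le fun v => by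
      rw [hconf x hx]
      exact mul_le_mul_of_nonneg_right (hM x hx) (norm_nonneg v))
  have hlim := tendsto_const_mul_nhdsGT_zero (inv_pos.2 hM0)
  have hev : ∀ᶠ r in 𝓝[>] (0 : ℝ),
      ENNReal.ofReal (m ^ n * M ^ (d - n)) * contApprox n d K (M⁻¹ * r) ≤
        contApprox n d (φ '' K) r := by
    filter_upwards [self_mem_nhdsWithin,
      hlim.eventually (nhdsWithin_le_nhds (Iic_mem_nhds hδ))] with r hr hrδ
    have hr : 0 < r := hr
    obtain ⟨h1, h2⟩ := hδK (M⁻¹ * r) (by positivity) hrδ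
    rw [mul_inv_cancel_left₀ hM0.ne'] at h2
    calc _ = ENNReal.ofReal (r ^ (d - (n : ℝ))) *
          (ENNReal.ofReal (m ^ n) * volume (cthickening (M⁻¹ * r) K)) := by
          rw [mul_left_comm, contApprox_mul_left (inv_pos.2 hM0) hr, ← mul_assoc,
            ← ENNReal.ofReal_mul (by positivity), Real.inv_rpow hM0.le, ← Real.rpow_neg hM0.le,
            neg_sub]
      _ ≤ _ := by
          rw [contApprox]
          gcongr
          exact (le_volume_image_of_conformal hinj hderiv hs hconf hm0.le hm
            isClosed_cthickening.measurableSet h1).trans (measure_mono h2)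
  calc _ ≤ ENNReal.ofReal (m ^ n * M ^ (d - n)) *
        liminf (fun r => contApprox n d K (M⁻¹ * r)) (𝓝[>] (0 : ℝ)) := by
        gcongr
        exact liminf_le_liminf_of_le hlim
    _ = liminf (fun r => ENNReal.ofReal (m ^ n * M ^ (d - n)) * contApprox n d K (M⁻¹ * r))
        (𝓝[>] (0 : ℝ)) := (ENNReal.liminf_const_mul_of_ne_top ENNReal.ofReal_ne_top).symm
    _ ≤ _ := liminf_le_liminf hev

end Conformal

lemma ennreal_limsup_add_le {α : Type*} {f : Filter α} (u v : α → ℝ≥0∞) :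
    limsup (fun x => u x + v x) f ≤ limsup u f + limsup v f := by
  rw [limsup_eq_iInf_iSup (u := u), limsup_eq_iInf_iSup (u := v)]
  exact ENNReal.le_iInf₂_add_iInf₂ fun s hs t ht => limsup_le_of_le (by isBoundedDefault)
    (eventually_of_mem (inter_mem hs ht) fun x hx =>
      add_le_add (le_iSup₂ (f := fun x _ => u x) x hx.1) (le_iSup₂ (f := fun x _ => v x) x hx.2))

lemma ennreal_le_liminf_add {α : Type*} {f : Filter α} (u v : α → ℝ≥0∞) :
    liminf u f + liminf v f ≤ liminf (fun x => u x + v x) f := by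
  rw [liminf_eq_iSup_iInf (u := u), liminf_eq_iSup_iInf (u := v)]
  exact ENNReal.biSup_add_biSup_le' ⟨univ, univ_mem⟩ ⟨univ, univ_mem⟩ fun s hs t ht =>
    le_liminf_of_le (by isBoundedDefault) (eventually_of_mem (inter_mem hs ht) fun x hx =>
      add_le_add (iInf₂_le (f := fun x _ => u x) x hx.1) (iInf₂_le (f := fun x _ => v x) x hx.2))

section Content

variable {n : ℕ} {d : ℝ}

lemma lowerCont_le_upperCont (K : Set (EuclideanSpace ℝ (Fin n))) :
    lowerCont n d K ≤ upperCont n d K :=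
  liminf_le_limsup

lemma upperCont_union_le (A B : Set (EuclideanSpace ℝ (Fin n))) :
    upperCont n d (A ∪ B) ≤ upperCont n d A + upperCont n d B := by
  refine le_trans (limsup_le_limsup (Eventually.of_forall fun r => ?_))
    (ennreal_limsup_add_le _ _)
  simp only [contApprox, cthickening_union]
  rw [← mul_add]
  gcongr
  exact measure_union_le _ _

lemma lowerCont_mono {A B : Set (EuclideanSpace ℝ (Fin n))} (h : A ⊆ B) :
    lowerCont n d A ≤ lowerCont n d B :=
  liminf_le_liminf (Eventually.of_forall fun r => by
    simp only [contApprox]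
    gcongr
    exact cthickening_subset_of_subset r h)

lemma le_lowerCont_union {A B : Set (EuclideanSpace ℝ (Fin n))} (hA : IsCompact A)
    (hB : IsCompact B) (hAB : Disjoint A B) :
    lowerCont n d A + lowerCont n d B ≤ lowerCont n d (A ∪ B) := by
  obtain ⟨δ, hδ, hdisj⟩ := hAB.exists_cthickenings hA hB.isClosed
  refine le_trans (ennreal_le_liminf_add _ _) (liminf_le_liminf ?_)
  filter_upwards [nhdsWithin_le_nhds (Iic_mem_nhds hδ)] with r hr
  simp only [contApprox, cthickening_union]
  rw [← mul_add, measure_union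
    (hdisj.mono (cthickening_mono hr _) (cthickening_mono hr _))
    isClosed_cthickening.measurableSet]

end Content

section RelBdry

variable {X : Type*} [TopologicalSpace X]

lemma relBdry_inter_sublevel_subset {S K : Set X} {g : X → ℝ} {t : ℝ}
    (hg : ∀ x ∈ S, ContinuousAt g x) (hK : IsClosed K) :
    relBdry S (K ∩ {x | g x ≤ t}) ⊆ relBdry S K ∪ (K ∩ {x | g x = t}) := by
  rintro x ⟨⟨hxS, hx⟩, hx'⟩
  have hxK : x ∈ K := hK.closure_subset (closure_mono inter_subset_left hx)
  have hle : g x ≤ t := by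
    by_contra! h
    obtain ⟨y, hy, hy'⟩ := mem_closure_iff_nhds.1 hx _ ((hg x hxS).eventually (lt_mem_nhds h))
    exact absurd (show g y ≤ t from hy'.2) (not_le.2 hy)
  have hsub : S \ (K ∩ {x | g x ≤ t}) ⊆ (S \ K) ∪ {x | t < g x} := by
    rintro y ⟨hyS, hy⟩
    by_cases hyK : y ∈ K
    · exact Or.inr (show t < g y from not_le.1 fun h => hy ⟨hyK, h⟩)
    · exact Or.inl ⟨hyS, hyK⟩
  have hx'' := closure_mono hsub hx'
  rw [closure_union] at hx''
  rcases hx'' with h | h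
  · exact Or.inl ⟨⟨hxS, subset_closure hxK⟩, h⟩
  · refine Or.inr ⟨hxK, le_antisymm hle ?_⟩
    by_contra! hlt
    obtain ⟨y, hy, hy'⟩ := mem_closure_iff_nhds.1 h _ ((hg x hxS).eventually (gt_mem_nhds hlt))
    exact lt_asymm (show g y < t from hy) hy'

lemma relBdry_inter_superlevel_subset {S K : Set X} {g : X → ℝ} {t : ℝ}
    (hg : ∀ x ∈ S, ContinuousAt g x) (hK : IsClosed K) :
    relBdry S (K ∩ {x | t ≤ g x}) ⊆ relBdry S K ∪ (K ∩ {x | g x = t}) := by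
  simpa only [neg_le_neg_iff, neg_inj] using
    relBdry_inter_sublevel_subset (g := fun x => -g x) (t := -t) (fun x hx => (hg x hx).neg) hK

lemma image_relBdry_subset {Y : Type*} [TopologicalSpace Y] {S K : Set X} {f : X → Y}
    (hf : ∀ x ∈ S, ContinuousAt f x) (hinj : InjOn f S) (hK : K ⊆ S) :
    f '' relBdry S K ⊆ relBdry (f '' S) (f '' K) := by
  rintro _ ⟨x, ⟨⟨hxS, hx⟩, hx'⟩, rfl⟩
  refine ⟨⟨mem_image_of_mem f hxS, ?_⟩, ?_⟩
  · exact mem_closure_image (hf x hxS) hx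
  · rw [← hinj.image_sdiff_subset hK]
    exact mem_closure_image (hf x hxS) hx'

lemma measurableSet_relBdry [MeasurableSpace X] [BorelSpace X] {S : Set X}
    (hS : MeasurableSet S) (K : Set X) : MeasurableSet (relBdry S K) :=
  (hS.inter isClosed_closure.measurableSet).inter isClosed_closure.measurableSet

end RelBdry

section Layers

variable {X : Type*} [TopologicalSpace X] [MeasurableSpace X] [BorelSpace X]
  {μ ρ : Measure X} {S K : Set X} {s : X → ℝ}

lemma countable_setOf_measure_level_pos (hs : ContinuousOn s K) (hK : IsClosed K)
    (hμK : μ K < ⊤) : {t : ℝ | 0 < μ (K ∩ {x | s x = t})}.Countable := by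
  have : IsFiniteMeasure (μ.restrict K) := ⟨by simpa using hμK⟩
  have hmeas : ∀ t : ℝ, MeasurableSet (K ∩ {x | s x = t}) := fun t =>
    (hs.preimage_isClosed_of_isClosed hK (isClosed_singleton (x := t))).measurableSet
  refine (Measure.countable_meas_pos_of_disjoint_iUnion (μ := μ.restrict K) hmeas ?_).mono ?_
  · intro t₁ t₂ ht
    refine disjoint_left.2 fun x hx₁ hx₂ => ht ?_
    exact hx₁.2.symm.trans hx₂.2
  · intro t ht
    simpa only [mem_ofPred_eq, Measure.restrict_eq_self μ inter_subset_left] using ht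

/-- If `l ≤ u` bracket a measure `ρ` up to constants on compact sets on which `s` varies by a factor
at most `q`, with `u` subadditive and `l` superadditive, then the same bounds hold on compact sets
on which `s` varies by a factor at most `q ^ N`. -/
lemma bounds_of_bounds_on_layers [T2Space X] (hs : ∀ x ∈ S, ContinuousAt s x) (hρ : ρ ≪ μ)
    (hμ : ∀ K ⊆ S, IsCompact K → μ K < ⊤) {l u : Set X → ℝ≥0∞} {c C : ℝ≥0∞} (hc : c ≠ ⊤)
    (hl_mono : ∀ A B, A ⊆ B → l A ≤ l B)
    (hl : ∀ A B, A ⊆ S → B ⊆ S → IsCompact A → IsCompact B → Disjoint A B →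
      l A + l B ≤ l (A ∪ B))
    (hu : ∀ A B, u (A ∪ B) ≤ u A + u B) {q a : ℝ} (hq : 1 < q) (ha : 0 < a)
    (hthin : ∀ b > 0, ∀ K ⊆ S, IsCompact K → μ (relBdry S K) = 0 →
      (∀ x ∈ K, b ≤ s x ∧ s x ≤ q * b) → c * ρ K ≤ l K ∧ u K ≤ C * ρ K) (N : ℕ) :
    ∀ K ⊆ S, IsCompact K → μ (relBdry S K) = 0 →
      (∀ k : ℕ, μ (K ∩ {x | s x = a * q ^ k}) = 0) →
      (∀ x ∈ K, a ≤ s x ∧ s x ≤ a * q ^ N) → c * ρ K ≤ l K ∧ u K ≤ C * ρ K := by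
  have hq0 : 0 < q := one_pos.trans hq
  induction N with
  | zero =>
    intro K hKS hK hbd _ hKs
    refine hthin a ha K hKS hK hbd fun x hx => ⟨(hKs x hx).1, ?_⟩
    have h := (hKs x hx).2
    rw [pow_zero, mul_one] at h
    nlinarith
  | succ N ih =>
    intro K hKS hK hbd hlev hKs
    have hsK : ContinuousOn s K := fun x hx => (hs x (hKS hx)).continuousWithinAt
    set t := a * q ^ N with ht
    have ht0 : 0 < t := by positivity
    have hclosed_le : IsClosed (K ∩ {x | s x ≤ t}) :=
      hsK.preimage_isClosed_of_isClosed hK.isClosed isClosed_Iic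
    have hclosed_ge : ∀ b, IsClosed (K ∩ {x | b ≤ s x}) := fun b =>
      hsK.preimage_isClosed_of_isClosed hK.isClosed isClosed_Ici
    have hle_compact : IsCompact (K ∩ {x | s x ≤ t}) :=
      hK.of_isClosed_subset hclosed_le inter_subset_left
    have hge_compact : ∀ b, IsCompact (K ∩ {x | b ≤ s x}) := fun b =>
      hK.of_isClosed_subset (hclosed_ge b) inter_subset_left
    have hsub : ∀ A : Set X, K ∩ A ⊆ S := fun A => inter_subset_left.trans hKS
    have hlow := ih (K ∩ {x | s x ≤ t}) (hsub _) hle_compact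
      (measure_mono_null (relBdry_inter_sublevel_subset hs hK.isClosed)
        (measure_union_null hbd (hlev N)))
      (fun k => measure_mono_null (inter_subset_inter_left _ inter_subset_left) (hlev k))
      (fun x hx => ⟨(hKs x hx.1).1, hx.2⟩)
    have hhigh : ∀ b, t ≤ b → μ (K ∩ {x | s x = b}) = 0 →
        c * ρ (K ∩ {x | b ≤ s x}) ≤ l (K ∩ {x | b ≤ s x}) ∧
          u (K ∩ {x | b ≤ s x}) ≤ C * ρ (K ∩ {x | b ≤ s x}) := by
      intro b hb hb0
      refine hthin b (ht0.trans_le hb) _ (hsub _) (hge_compact b)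
        (measure_mono_null (relBdry_inter_superlevel_subset hs hK.isClosed)
          (measure_union_null hbd hb0)) fun x hx => ⟨hx.2, (hKs x hx.1).2.trans ?_⟩
      calc a * q ^ (N + 1) = q * t := by rw [ht]; ring
        _ ≤ q * b := by gcongr
    have hρlev : ρ (K ∩ {x | s x = t}) = 0 := hρ (hlev N)
    have hcompl : K \ (K ∩ {x | s x ≤ t}) = K ∩ {x | t < s x} := by
      ext x
      simp
    have hρK : ρ (K ∩ {x | s x ≤ t}) + ρ (K ∩ {x | t < s x}) = ρ K := by
      have h := measure_inter_add_sdiff (μ := ρ) K hclosed_le.measurableSet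
      rwa [inter_eq_self_of_subset_right inter_subset_left, hcompl] at h
    constructor
    · obtain ⟨b, hb_anti, hb_mem, hb_lim⟩ :=
        ((countable_setOf_measure_level_pos hsK hK.isClosed
          (hμ K hKS hK)).dense_compl ℝ).exists_seq_strictAnti_tendsto t
      have hUnion : ⋃ k, K ∩ {x | b k ≤ s x} = K ∩ {x | t < s x} := by
        ext x
        simp only [mem_iUnion, mem_inter_iff, mem_ofPred_eq, exists_and_left]
        refine and_congr_right fun _ => ⟨fun ⟨k, hk⟩ => (hb_mem k).1.trans_le hk, fun hx => ?_⟩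
        exact ((hb_lim.eventually (gt_mem_nhds hx)).exists).imp fun k hk => hk.le
      have hlim : Tendsto (fun k => ρ (K ∩ {x | b k ≤ s x})) atTop
          (𝓝 (ρ (K ∩ {x | t < s x}))) := by
        rw [← hUnion]
        exact tendsto_measure_iUnion_atTop fun i j hij x hx =>
          ⟨hx.1, (hb_anti.antitone hij).trans hx.2⟩
      rw [← hρK, mul_add]
      refine le_of_tendsto' ((ENNReal.Tendsto.const_mul hlim (Or.inr hc)).const_add _)
        fun k => ?_
      have hb0 : μ (K ∩ {x | s x = b k}) = 0 := by
        by_contra h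
        exact (hb_mem k).2 (pos_iff_ne_zero.2 h)
      refine (add_le_add hlow.1 (hhigh (b k) (hb_mem k).1.le hb0).1).trans ?_
      refine (hl _ _ (hsub _) (hsub _) hle_compact (hge_compact _) ?_).trans
        (hl_mono _ _ (union_subset inter_subset_left inter_subset_left))
      exact disjoint_left.2 fun x hx hx' =>
        absurd (le_trans (show b k ≤ s x from hx'.2) (show s x ≤ t from hx.2))
          (not_le.2 (show t < b k from (hb_mem k).1))
    · have hK_union : K = (K ∩ {x | s x ≤ t}) ∪ (K ∩ {x | t ≤ s x}) := by
        rw [← inter_union_distrib_left, eq_comm, inter_eq_left]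
        exact fun x _ => le_total (s x) t
      have hρge : ρ (K ∩ {x | t ≤ s x}) ≤ ρ (K ∩ {x | t < s x}) := by
        have h : K ∩ {x | t ≤ s x} ⊆ (K ∩ {x | s x = t}) ∪ (K ∩ {x | t < s x}) := fun x hx =>
          (eq_or_lt_of_le hx.2).elim (fun h => Or.inl ⟨hx.1, h.symm⟩) fun h => Or.inr ⟨hx.1, h⟩
        refine (measure_mono h).trans ((measure_union_le _ _).trans ?_)
        rw [hρlev, zero_add]
      calc u K = u ((K ∩ {x | s x ≤ t}) ∪ (K ∩ {x | t ≤ s x})) := by rw [← hK_union]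
        _ ≤ C * ρ (K ∩ {x | s x ≤ t}) + C * ρ (K ∩ {x | t ≤ s x}) :=
          (hu _ _).trans (add_le_add hlow.2 (hhigh t le_rfl (hlev N)).2)
        _ ≤ C * ρ K := by
          rw [← mul_add, ← hρK]
          gcongr

lemma exists_pos_measure_geometric_levels_eq_zero [T2Space X] (hs : ContinuousOn s K) (hK : IsCompact K)
    (hμK : μ K < ⊤) (hpos : ∀ x ∈ K, 0 < s x) {q : ℝ} (hq : 1 < q) :
    ∃ a > 0, (∀ k : ℕ, μ (K ∩ {x | s x = a * q ^ k}) = 0) ∧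
      ∃ N : ℕ, ∀ x ∈ K, a ≤ s x ∧ s x ≤ a * q ^ N := by
  have hq0 : 0 < q := one_pos.trans hq
  obtain ⟨M, hM⟩ := hK.exists_bound_of_continuousOn hs
  obtain ⟨M', hM'⟩ := hK.exists_bound_of_continuousOn (hs.inv₀ fun x hx => (hpos x hx).ne')
  have hcount : (⋃ k : ℕ, (fun t : ℝ => t / q ^ k) ''
      {t : ℝ | 0 < μ (K ∩ {x | s x = t})}).Countable :=
    countable_iUnion fun k =>
      (countable_setOf_measure_level_pos hs hK.isClosed hμK).image _
  obtain ⟨a, ha, ha0, ha1⟩ := (hcount.dense_compl ℝ).exists_between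
    (show (0 : ℝ) < (max M' 1)⁻¹ by positivity)
  refine ⟨a, ha0, fun k => ?_, ?_⟩
  · by_contra h
    refine ha (mem_iUnion.2 ⟨k, a * q ^ k, pos_iff_ne_zero.2 h, ?_⟩)
    simp [hq0.ne']
  · obtain ⟨N, hN⟩ := pow_unbounded_of_one_lt (M / a) hq
    refine ⟨N, fun x hx => ⟨ha1.le.trans ?_, ?_⟩⟩
    · have h := (le_abs_self _).trans ((hM' x hx).trans (le_max_left M' 1))
      exact inv_le_of_inv_le₀ (hpos x hx) h
    · rw [div_lt_iff₀' ha0] at hN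
      exact (le_abs_self _).trans ((hM x hx).trans hN.le)

end Layers

lemma sq_mul_pow_mul_div_rpow {q b : ℝ} (hq : 0 < q) (hb : 0 < b) (n : ℕ) (d : ℝ) :
    (q ^ 2 * b) ^ n * (b / q) ^ (d - n) = q ^ (3 * n - d) * b ^ d := by
  rw [mul_pow, Real.div_rpow hb.le hq.le, ← pow_mul, div_eq_mul_inv, ← Real.rpow_neg hq.le,
    ← Real.rpow_natCast, ← Real.rpow_natCast]
  calc q ^ ((2 * n : ℕ) : ℝ) * b ^ (n : ℝ) * (b ^ (d - n) * q ^ (-(d - n)))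
      = (q ^ ((2 * n : ℕ) : ℝ) * q ^ (-(d - n))) * (b ^ (n : ℝ) * b ^ (d - n)) := by ring
    _ = _ := by
      rw [← Real.rpow_add hq, ← Real.rpow_add hb]
      congr 2 <;> push_cast <;> ring

lemma div_pow_mul_sq_mul_rpow {q b : ℝ} (hq : 0 < q) (hb : 0 < b) (n : ℕ) (d : ℝ) :
    (b / q) ^ n * (q ^ 2 * b) ^ (d - n) = q ^ (2 * d - 3 * n) * b ^ d := by
  have h : (q ^ 2 : ℝ) ^ (d - n) = q ^ (2 * (d - n)) := by
    rw [← Real.rpow_natCast, ← Real.rpow_mul hq.le]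
    norm_num
  rw [Real.mul_rpow (by positivity) hb.le, h, div_pow, ← Real.rpow_natCast, ← Real.rpow_natCast,
    div_eq_mul_inv, ← Real.rpow_neg hq.le]
  calc b ^ (n : ℝ) * q ^ (-(n : ℝ)) * (q ^ (2 * (d - n)) * b ^ (d - n))
      = (q ^ (-(n : ℝ)) * q ^ (2 * (d - n))) * (b ^ (n : ℝ) * b ^ (d - n)) := by ring
    _ = _ := by
      rw [← Real.rpow_add hq, ← Real.rpow_add hb]
      congr 2 <;> ring

section WeightedMeasure

variable {n : ℕ} {d : ℝ} {G S : Set (EuclideanSpace ℝ (Fin n))}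
  {φ : EuclideanSpace ℝ (Fin n) → EuclideanSpace ℝ (Fin n)}
  {φ' : EuclideanSpace ℝ (Fin n) → (EuclideanSpace ℝ (Fin n) →L[ℝ] EuclideanSpace ℝ (Fin n))}
  {s : EuclideanSpace ℝ (Fin n) → ℝ} {μ : Measure (EuclideanSpace ℝ (Fin n))}

lemma continuousOn_of_conformal (hn : 1 ≤ n) (hcont : ContinuousOn φ' G)
    (hconf : ∀ x ∈ G, ∀ v, ‖φ' x v‖ = s x * ‖v‖) : ContinuousOn s G := by
  have : Nonempty (Fin n) := ⟨⟨0, hn⟩⟩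
  refine hcont.norm.congr fun x hx => ?_
  exact (ContinuousLinearMap.homothety_norm (φ' x) (hconf x hx)).symm

lemma content_image_bounds_of_mem_Icc (hd0 : 0 < d) (hdn : d < n) (hG : IsOpen G)
    (hinj : InjOn φ G) (hderiv : ∀ x ∈ G, HasFDerivAt φ (φ' x) x) (hcont : ContinuousOn φ' G)
    (hs : ContinuousOn s G) (hconf : ∀ x ∈ G, ∀ v, ‖φ' x v‖ = s x * ‖v‖)
    {K : Set (EuclideanSpace ℝ (Fin n))} (hK : IsCompact K) (hKG : K ⊆ G)
    (hμK : ContEq n d K (μ K)) {q b : ℝ} (hq : 1 < q) (hb : 0 < b)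
    (hKs : ∀ x ∈ K, b ≤ s x ∧ s x ≤ q * b) :
    ENNReal.ofReal (q ^ (-(4 * n : ℝ))) * μ.withDensity (fun x => ENNReal.ofReal (s x ^ d)) K ≤
        lowerCont n d (φ '' K) ∧
      upperCont n d (φ '' K) ≤
        ENNReal.ofReal (q ^ (4 * n : ℝ)) *
          μ.withDensity (fun x => ENNReal.ofReal (s x ^ d)) K := by
  have hq0 : 0 < q := one_pos.trans hq
  have hU : IsOpen (G ∩ s ⁻¹' Ioo (b / q) (q ^ 2 * b)) := hs.isOpen_inter_preimage hG isOpen_Ioo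
  have hKU : K ⊆ G ∩ s ⁻¹' Ioo (b / q) (q ^ 2 * b) := fun x hx =>
    ⟨hKG hx, (div_lt_self hb hq).trans_le (hKs x hx).1, (hKs x hx).2.trans_lt (by
      rw [sq, mul_assoc]
      exact lt_mul_of_one_lt_left (by positivity) hq)⟩
  have hupper := upperCont_image_le_of_conformal (d := d) hU (hinj.mono inter_subset_left)
    (fun x hx => hderiv x hx.1) (hcont.mono inter_subset_left) (div_pos hb hq0)
    (fun x hx => hx.2.1.le) (by positivity) (fun x hx => hx.2.2.le) (fun x hx => hconf x hx.1)
    hK hKU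
  have hlower := le_lowerCont_image_of_conformal (d := d) hU (hinj.mono inter_subset_left)
    (fun x hx => hderiv x hx.1) (div_pos hb hq0)
    (fun x hx => hx.2.1.le) (by positivity) (fun x hx => hx.2.2.le) (fun x hx => hconf x hx.1)
    hK hKU
  rw [hμK.1, sq_mul_pow_mul_div_rpow hq0 hb] at hupper
  rw [hμK.2, div_pow_mul_sq_mul_rpow hq0 hb] at hlower
  rw [withDensity_apply _ hK.measurableSet]
  constructor
  · refine le_trans ?_ hlower
    have h : ∫⁻ x in K, ENNReal.ofReal (s x ^ d) ∂μ ≤ ENNReal.ofReal ((q * b) ^ d) * μ K := by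
      rw [← setLIntegral_const]
      refine setLIntegral_mono' hK.measurableSet fun x hx => ENNReal.ofReal_le_ofReal ?_
      exact Real.rpow_le_rpow (hb.le.trans (hKs x hx).1) (hKs x hx).2 hd0.le
    refine (mul_le_mul_right h _).trans ?_
    rw [← mul_assoc, ← ENNReal.ofReal_mul (by positivity)]
    rw [Real.mul_rpow hq0.le hb.le, ← mul_assoc, ← Real.rpow_add hq0]
    gcongr
    · exact hq.le
    · linarith
  · refine hupper.trans ?_
    have h : ENNReal.ofReal (b ^ d) * μ K ≤ ∫⁻ x in K, ENNReal.ofReal (s x ^ d) ∂μ := by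
      rw [← setLIntegral_const]
      refine setLIntegral_mono' hK.measurableSet fun x hx => ENNReal.ofReal_le_ofReal ?_
      exact Real.rpow_le_rpow hb.le (hKs x hx).1 hd0.le
    refine le_trans ?_ (mul_le_mul_right h _)
    rw [← mul_assoc, ← ENNReal.ofReal_mul (by positivity)]
    gcongr
    · exact hq.le
    · linarith

lemma contEq_image_of_conformal (hd0 : 0 < d) (hdn : d < n) (hG : IsOpen G)
    (hinj : InjOn φ G) (hderiv : ∀ x ∈ G, HasFDerivAt φ (φ' x) x) (hcont : ContinuousOn φ' G)
    (hs : ContinuousOn s G) (hs_pos : ∀ x ∈ G, 0 < s x)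
    (hconf : ∀ x ∈ G, ∀ v, ‖φ' x v‖ = s x * ‖v‖) (hSG : S ⊆ G) (hμ : IsMinkowskiMeasure n d S μ)
    {K : Set (EuclideanSpace ℝ (Fin n))} (hK : IsCompact K) (hKS : K ⊆ S)
    (hbd : μ (relBdry S K) = 0) :
    ContEq n d (φ '' K) (μ.withDensity (fun x => ENNReal.ofReal (s x ^ d)) K) := by
  set ρ := μ.withDensity (fun x => ENNReal.ofReal (s x ^ d)) with hρ
  have hφc : ContinuousOn φ G := fun x hx => (hderiv x hx).continuousAt.continuousWithinAt
  have hsAt : ∀ x ∈ S, ContinuousAt s x := fun x hx =>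
    hs.continuousAt (hG.mem_nhds (hSG hx))
  have hbounds : ∀ q : ℝ, 1 < q →
      ENNReal.ofReal (q ^ (-(4 * n : ℝ))) * ρ K ≤ lowerCont n d (φ '' K) ∧
        upperCont n d (φ '' K) ≤ ENNReal.ofReal (q ^ (4 * n : ℝ)) * ρ K := by
    intro q hq
    obtain ⟨a, ha, hlev, N, hN⟩ := exists_pos_measure_geometric_levels_eq_zero
      (hs.mono (hKS.trans hSG)) hK (hμ.2 K hKS hK).1 (fun x hx => hs_pos x (hSG (hKS hx))) hq
    refine bounds_of_bounds_on_layers (l := fun A => lowerCont n d (φ '' A))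
      (u := fun A => upperCont n d (φ '' A)) hsAt (withDensity_absolutelyContinuous _ _)
      (fun A hAS hA => (hμ.2 A hAS hA).1) ENNReal.ofReal_ne_top
      (fun A B hAB => lowerCont_mono (image_mono hAB)) ?_ ?_ hq ha ?_ N K hKS hK hbd hlev hN
    · intro A B hAS hBS hA hB hAB
      simp only [image_union]
      exact le_lowerCont_union (hA.image_of_continuousOn (hφc.mono (hAS.trans hSG)))
        (hB.image_of_continuousOn (hφc.mono (hBS.trans hSG)))
        (hAB.image hinj (hAS.trans hSG) (hBS.trans hSG))
    · intro A B
      simp only [image_union]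
      exact upperCont_union_le _ _
    · intro b hb A hAS hA hAbd hAs
      exact content_image_bounds_of_mem_Icc hd0 hdn hG hinj hderiv hcont hs hconf hA
        (hAS.trans hSG) ((hμ.2 A hAS hA).2 hAbd) hq hb hAs
  have hlim : ∀ e : ℝ, Tendsto (fun q : ℝ => ENNReal.ofReal (q ^ e) * ρ K) (𝓝[>] 1)
      (𝓝 (ρ K)) := by
    intro e
    have h : Tendsto (fun q : ℝ => ENNReal.ofReal (q ^ e)) (𝓝[>] 1) (𝓝 1) := by
      have h' := ENNReal.tendsto_ofReal
        (Real.continuousAt_rpow_const 1 e (Or.inl one_ne_zero)).tendsto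
      rw [Real.one_rpow, ENNReal.ofReal_one] at h'
      exact h'.mono_left nhdsWithin_le_nhds
    simpa using ENNReal.Tendsto.mul_const h (Or.inl one_ne_zero)
  have hle : ρ K ≤ lowerCont n d (φ '' K) := le_of_tendsto (hlim _) <| by
    filter_upwards [self_mem_nhdsWithin] with q hq using (hbounds q hq).1
  have hge : upperCont n d (φ '' K) ≤ ρ K := ge_of_tendsto (hlim _) <| by
    filter_upwards [self_mem_nhdsWithin] with q hq using (hbounds q hq).2
  have hlu := lowerCont_le_upperCont (d := d) (φ '' K)
  exact ⟨hge.antisymm (hle.trans hlu), (hlu.trans hge).antisymm hle⟩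

end WeightedMeasure

/-- Conformal covariance: the pushforward under an injective conformal `C¹` map
`φ` of a Minkowski content measure weighted by `|φ'|^d` is the Minkowski content measure on the
image. -/
theorem minkowskiMeasure_conformal_covariance (n : ℕ) (hn : 1 ≤ n) (d : ℝ)
    (hd0 : 0 < d) (hdn : d < n)
    (G : Set (EuclideanSpace ℝ (Fin n))) (hG : IsOpen G)
    (φ : EuclideanSpace ℝ (Fin n) → EuclideanSpace ℝ (Fin n))
    (φ' : EuclideanSpace ℝ (Fin n) → (EuclideanSpace ℝ (Fin n) →L[ℝ] EuclideanSpace ℝ (Fin n)))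
    (s : EuclideanSpace ℝ (Fin n) → ℝ)
    (hinj : InjOn φ G)
    (hderiv : ∀ x ∈ G, HasFDerivAt φ (φ' x) x)
    (hderiv_cont : ContinuousOn φ' G)
    (hs_pos : ∀ x ∈ G, 0 < s x)
    (hconf : ∀ x ∈ G, ∀ v : EuclideanSpace ℝ (Fin n), ‖φ' x v‖ = s x * ‖v‖)
    (S : Set (EuclideanSpace ℝ (Fin n))) (F : Set (EuclideanSpace ℝ (Fin n))) (hF : IsClosed F) (hSFG : S = F ∩ G)
    (μ : Measure (EuclideanSpace ℝ (Fin n))) (hμ : IsMinkowskiMeasure n d S μ) :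
    MemM n (φ '' S) ∧
      IsMinkowskiMeasure n d (φ '' S)
        (Measure.map φ (μ.withDensity fun x => ENNReal.ofReal (s x ^ d))) := by
  have hs := continuousOn_of_conformal hn hderiv_cont hconf
  have hφAt : ∀ x ∈ G, ContinuousAt φ x := fun x hx => (hderiv x hx).continuousAt
  have hφc : ContinuousOn φ G := fun x hx => (hφAt x hx).continuousWithinAt
  have hSG : S ⊆ G := hSFG ▸ inter_subset_right
  have hSm : MeasurableSet S := hSFG ▸ hF.measurableSet.inter hG.measurableSet
  have hMemM : MemM n (φ '' S) := by
    refine ⟨φ '' G, (φ '' (G \ F))ᶜ,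
      isOpen_image_of_conformal hG hderiv hderiv_cont hs_pos hconf hG Subset.rfl,
      (isOpen_image_of_conformal hG hderiv hderiv_cont hs_pos hconf (hG.sdiff hF)
        sdiff_subset).isClosed_compl, ?_⟩
    rw [← sdiff_eq, ← hinj.image_sdiff_subset sdiff_subset, sdiff_sdiff_right_self, hSFG]
    exact congrArg (φ '' ·) (inter_comm F G)
  have hφS_meas : MeasurableSet (φ '' S) := by
    obtain ⟨U, C, hU, hC, h⟩ := hMemM
    exact h ▸ hU.measurableSet.inter hC.measurableSet
  have hμG : μ.restrict G = μ := Measure.restrict_eq_self_of_ae_mem <|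
    measure_mono_null (compl_subset_compl.2 hSG) hμ.1
  have hdens : AEMeasurable (fun x => ENNReal.ofReal (s x ^ d)) μ := by
    rw [← hμG]
    exact ((hs.aemeasurable hG.measurableSet).pow_const d).ennreal_ofReal
  set ρ := μ.withDensity fun x => ENNReal.ofReal (s x ^ d) with hρ
  have hρμ : ρ ≪ μ := withDensity_absolutelyContinuous _ _
  have hφm : AEMeasurable φ ρ := by
    refine AEMeasurable.mono_ac ?_ hρμ
    rw [← hμG]
    exact hφc.aemeasurable hG.measurableSet
  have hmap : ∀ K ⊆ S, MeasurableSet (φ '' K) → Measure.map φ ρ (φ '' K) = ρ K := by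
    intro K hKS hK
    rw [Measure.map_apply_of_aemeasurable hφm hK]
    refine le_antisymm ?_ (measure_mono (subset_preimage_image φ K))
    have hsub : φ ⁻¹' (φ '' K) ⊆ K ∪ Sᶜ := by
      rintro x ⟨y, hy, hyx⟩
      by_cases hx : x ∈ S
      · exact Or.inl (hinj (hSG (hKS hy)) (hSG hx) hyx ▸ hy)
      · exact Or.inr hx
    refine (measure_mono hsub).trans ((measure_union_le _ _).trans ?_)
    rw [hρμ hμ.1, add_zero]
  refine ⟨hMemM, ?_, ?_⟩
  · rw [Measure.map_apply_of_aemeasurable hφm hφS_meas.compl]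
    exact measure_mono_null (fun x hx hxS => hx (mem_image_of_mem φ hxS)) (hρμ hμ.1)
  · intro K' hK'S hK'
    obtain ⟨K, hKS, rfl⟩ : ∃ K ⊆ S, φ '' K = K' := subset_image_iff.1 hK'S
    have hK : IsCompact K := by
      rw [← hinj.invFunOn_image (hKS.trans hSG)]
      refine hK'.image_of_continuousOn ?_
      rintro _ ⟨x, hx, rfl⟩
      exact (continuousAt_invFunOn_of_conformal hG hinj hderiv hderiv_cont hs_pos hconf
        (hSG (hKS hx))).continuousWithinAt
    rw [hmap K hKS hK'.measurableSet]
    constructor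
    · obtain ⟨M, hM⟩ := hK.exists_bound_of_continuousOn
        ((hs.mono (hKS.trans hSG)).rpow_const fun x _ => Or.inr hd0.le)
      rw [hρ, withDensity_apply _ hK.measurableSet]
      calc ∫⁻ x in K, ENNReal.ofReal (s x ^ d) ∂μ ≤ ∫⁻ _ in K, ENNReal.ofReal M ∂μ :=
            setLIntegral_mono' hK.measurableSet fun x hx =>
              ENNReal.ofReal_le_ofReal ((le_abs_self _).trans (hM x hx))
        _ = ENNReal.ofReal M * μ K := setLIntegral_const _ _
        _ < ⊤ := ENNReal.mul_lt_top ENNReal.ofReal_lt_top (hμ.2 K hKS hK).1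
    · intro hbd
      refine contEq_image_of_conformal hd0 hdn hG hinj hderiv hderiv_cont hs hs_pos hconf hSG hμ
        hK hKS ?_
      have hbdS : relBdry S K ⊆ S := fun x hx => hx.1.1
      have hρbd : ρ (relBdry S K) = 0 := by
        refine measure_mono_null (image_subset_iff.1 (image_relBdry_subset
          (fun x hx => hφAt x (hSG hx)) (hinj.mono hSG) hKS)) ?_
        rwa [Measure.map_apply_of_aemeasurable hφm (measurableSet_relBdry hφS_meas _)] at hbd
      rw [hρ, withDensity_apply_eq_zero' hdens] at hρbd
      refine measure_mono_null (subset_inter (fun x hx => ?_) Subset.rfl) hρbd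
      exact (ENNReal.ofReal_pos.2 (Real.rpow_pos_of_pos (hs_pos x (hSG (hbdS hx))) d)).ne'
end
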